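/- Let k be a field of characteristic 0 and let n ≥ 1. Fix 1 ≤ i ≤ n and polynomials f_1, …, f_{i−1} in k[x_0, …, x_n] such that (f_1, …, f_{i−1}) is a regular sequence. Fix an integer d ≥ 1. Then the set Z_i of homogeneous polynomials f of degree d in k[x_0, …, x_n] such that (f_1, …, f_{i−1}, f) is NOT a regular sequence is contained in a finite union of k-linear subspaces of the space of homogeneous polynomials of degree d, each of codimension at least 2. -/

import Mathlib

open CategoryTheory CategoryTheory.Abelian ModuleCat in
theorem subsingleton_linearMap_quotient_of_subsingleton_ext.{u} {R : Type u} [CommRing R]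
    (N : ModuleCat.{u} R) (fs : List R) (M : ModuleCat.{u} R)
    (hfs : RingTheory.Sequence.IsWeaklyRegular M fs)
    (hext : ∀ i ≤ fs.length, Subsingleton (Ext N M i)) :
    Subsingleton (N →ₗ[R] M ⧸ (Ideal.ofList fs • ⊤ : Submodule R M)) := by
  induction fs generalizing M with
  | nil =>
    have := hext 0 le_rfl
    have h : Subsingleton (N →ₗ[R] M) :=
      ((Ext.addEquiv₀.trans ModuleCat.homAddEquiv).symm.toEquiv.subsingleton)
    exact (LinearEquiv.congrRight (Submodule.quotEquivOfEqBot _ (by simp))).toEquiv.subsingleton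
  | cons a fs ih =>
    rw [RingTheory.Sequence.isWeaklyRegular_cons_iff] at hfs
    have key := ih (ModuleCat.of R (QuotSMulTop a M)) hfs.2 fun i hi ↦ by
      have zero1 := AddCommGrpCat.isZero_of_iff_subsingleton.mpr (hext i (by grind))
      have zero2 := AddCommGrpCat.isZero_of_iff_subsingleton.mpr (hext (i + 1) (by grind))
      exact AddCommGrpCat.subsingleton_of_isZero <| ShortComplex.Exact.isZero_of_both_zeros
        ((Ext.covariant_sequence_exact₃' N hfs.1.smulShortComplex_shortExact) i (i + 1) rfl)
        (zero1.eq_zero_of_src _) (zero2.eq_zero_of_tgt _)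
    exact (LinearEquiv.congrRight
      (Submodule.quotOfListConsSMulTopEquivQuotSMulTopInner M a fs)).toEquiv.subsingleton

open CategoryTheory CategoryTheory.Abelian ModuleCat in
theorem mem_ofList_of_isWeaklyRegular_of_length_lt {R : Type*} [CommRing R] [IsNoetherianRing R]
    {P : Ideal R} (hP : P ≠ ⊤) {gs fs : List R}
    (hgs : RingTheory.Sequence.IsWeaklyRegular R gs) (hgP : ∀ g ∈ gs, g ∈ P)
    (hfs : RingTheory.Sequence.IsWeaklyRegular R fs) (hlt : fs.length < gs.length)
    {x : R} (hx : ∀ p ∈ P, p * x ∈ Ideal.ofList fs) : x ∈ Ideal.ofList fs := by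
  have hle : P • (⊤ : Submodule R R) < ⊤ := by simpa [lt_top_iff_ne_top] using hP
  have hreg : RingTheory.Sequence.IsRegular R gs := by
    refine ⟨hgs, fun h ↦ hP ?_⟩
    rw [smul_eq_mul, Ideal.mul_top] at h
    exact top_le_iff.1 (h.le.trans (Ideal.span_le.2 hgP))
  have hext := subsingleton_ext_of_exists_isRegular P (ModuleCat.of R (R ⧸ P))
    (by rw [Module.support_eq_zeroLocus, Ideal.annihilator_quotient]) (ModuleCat.of R R)
    hle gs hgP hreg
  have hsub := subsingleton_linearMap_quotient_of_subsingleton_ext (ModuleCat.of R (R ⧸ P)) fs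
    (ModuleCat.of R R) hfs fun i hi ↦ hext i (by omega)
  let φ : (R ⧸ P) →ₗ[R] R ⧸ (Ideal.ofList fs • ⊤ : Submodule R R) :=
    Submodule.liftQ P ((Submodule.mkQ _).comp (LinearMap.toSpanSingleton R R x)) fun p hp ↦ by
      suffices p * x ∈ (Ideal.ofList fs • ⊤ : Submodule R R) by
        simpa only [LinearMap.mem_ker, LinearMap.comp_apply, LinearMap.toSpanSingleton_apply,
          Submodule.mkQ_apply, Submodule.Quotient.mk_eq_zero, smul_eq_mul] using this
      simpa using hx p hp
  have h0 : φ = 0 := Subsingleton.elim _ _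
  have := LinearMap.congr_fun h0 (Submodule.Quotient.mk 1)
  have hx' : x ∈ (Ideal.ofList fs • ⊤ : Submodule R R) := by
    simpa only [φ, ← Submodule.mkQ_apply, Submodule.liftQ_mkQ, Submodule.liftQ_apply,
      LinearMap.comp_apply, LinearMap.toSpanSingleton_apply, one_smul, LinearMap.zero_apply,
      Submodule.mkQ_apply, Submodule.Quotient.mk_eq_zero] using this
  simpa using hx'

open RingTheory.Sequence in
theorem isWeaklyRegular_append_singleton_iff {R : Type*} [CommRing R] (rs : List R) (r : R) :
    IsWeaklyRegular R (rs ++ [r]) ↔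
      IsWeaklyRegular R rs ∧ ∀ x, r * x ∈ Ideal.ofList rs → x ∈ Ideal.ofList rs := by
  rw [isWeaklyRegular_append_iff, isWeaklyRegular_singleton_iff]
  refine and_congr_right fun _ ↦ ?_
  rw [isSMulRegular_iff_right_eq_zero_of_smul]
  refine (Submodule.mkQ_surjective _).forall.trans (forall_congr' fun x ↦ ?_)
  rw [← map_smul, Submodule.mkQ_apply, Submodule.mkQ_apply, Submodule.Quotient.mk_eq_zero,
    Submodule.Quotient.mk_eq_zero, smul_eq_mul, smul_eq_mul, Ideal.mul_top]

theorem RingEquiv.isWeaklyRegular_congr {R S : Type*} [CommRing R] [CommRing S] (e : R ≃+* S)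
    (rs : List R) : RingTheory.Sequence.IsWeaklyRegular R rs ↔
      RingTheory.Sequence.IsWeaklyRegular S (rs.map e) :=
  e.toAddEquiv.isWeaklyRegular_congr <| List.forall₂_map_right_iff.mpr <|
    List.forall₂_same.mpr fun r _ x ↦ e.map_mul r x

open Polynomial in
theorem mem_nonZeroDivisors_of_contentIdeal_eq_top {R : Type*} [CommRing R] {p : R[X]}
    (hp : p.contentIdeal = ⊤) : p ∈ nonZeroDivisors R[X] := by
  refine Polynomial.mem_nonZeroDivisors_iff.2 fun a ha ↦ ?_
  have h : p.contentIdeal ≤ Submodule.annihilator (Ideal.span {a}) := by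
    refine Ideal.span_le.2 fun c hc ↦ ?_
    obtain ⟨m, -, rfl⟩ := mem_coeffs_iff.1 hc
    rw [SetLike.mem_coe, Submodule.mem_annihilator_span_singleton, smul_eq_mul, mul_comm,
      ← smul_eq_mul, ← coeff_smul, ha, coeff_zero]
  rw [hp] at h
  simpa using (Submodule.mem_annihilator_span_singleton a 1).1 (h Submodule.mem_top)

open RingTheory.Sequence Polynomial in
theorem isWeaklyRegular_map_C_append_singleton {R : Type*} [CommRing R] {rs : List R}
    (hrs : IsWeaklyRegular R rs) {p : R[X]} (hp : p.contentIdeal = ⊤) :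
    IsWeaklyRegular R[X] (rs.map C ++ [p]) := by
  refine (isWeaklyRegular_append_singleton_iff _ _).2 ⟨hrs.of_flat, fun q hq ↦ ?_⟩
  have key (f : R[X]) : f ∈ Ideal.ofList (rs.map C) ↔
      f.map (Ideal.Quotient.mk (Ideal.ofList rs)) = 0 := by
    rw [← Ideal.map_ofList, Ideal.mem_map_C_iff, Polynomial.ext_iff]
    simp [Ideal.Quotient.eq_zero_iff_mem]
  rw [key, Polynomial.map_mul] at hq
  rw [key]
  refine (mul_left_mem_nonZeroDivisors_eq_zero_iff
    (mem_nonZeroDivisors_of_contentIdeal_eq_top ?_)).1 hq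
  rw [contentIdeal_map_eq_map_contentIdeal, hp, Ideal.map_top]

open RingTheory.Sequence Polynomial in
theorem isWeaklyRegular_ofFn_aeval_X_reverse {D : Type*} [CommRing D] {n : ℕ} (g : Fin n → D[X])
    (hg : ∀ j, (g j).contentIdeal = ⊤) :
    IsWeaklyRegular (MvPolynomial (Fin n) D)
      (List.ofFn fun j ↦ aeval (MvPolynomial.X j : MvPolynomial (Fin n) D) (g j)).reverse := by
  induction n with
  | zero => simp
  | succ n ih =>
    rw [(MvPolynomial.finSuccEquiv D n).toRingEquiv.isWeaklyRegular_congr]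
    convert isWeaklyRegular_map_C_append_singleton (ih (fun j ↦ g j.succ) fun j ↦ hg j.succ)
      (p := (g 0).map (algebraMap D (MvPolynomial (Fin n) D))) ?_ using 1
    · simp only [List.ofFn_succ, List.reverse_cons, List.map_append, List.map_reverse,
        List.map_ofFn]
      congr 2
      · congr 1
        ext j : 1
        change MvPolynomial.finSuccEquiv D n _ = algebraMap (MvPolynomial (Fin n) D) _ _
        rw [← Polynomial.aeval_algHom_apply, MvPolynomial.finSuccEquiv_X_succ]
        exact aeval_algebraMap_apply _ _ _
      · simp only [List.map_cons, List.map_nil]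
        congr 1
        change MvPolynomial.finSuccEquiv D n _ = _
        rw [← Polynomial.aeval_algHom_apply, MvPolynomial.finSuccEquiv_X_zero]
        exact aeval_X_left_eq_map _
    · rw [contentIdeal_map_eq_map_contentIdeal, hg, Ideal.map_top]

open RingTheory.Sequence Polynomial in
theorem exists_isWeaklyRegular_of_eval₂_eq_zero {k A : Type*} [Field k] [CommRing A]
    [Algebra k A] {n : ℕ} (φ : MvPolynomial (Fin (n + 1)) k →ₐ[k] A) (j₀ : Fin (n + 1))
    (h : ∀ j, ∃ g : k[X][X], g.contentIdeal = ⊤ ∧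
      g.eval₂ (aeval (R := k) (φ (.X j₀))).toRingHom (φ (.X (j₀.succAbove j))) = 0) :
    ∃ gs : List (MvPolynomial (Fin (n + 1)) k), gs.length = n ∧
      IsWeaklyRegular (MvPolynomial (Fin (n + 1)) k) gs ∧ ∀ g ∈ gs, φ g = 0 := by
  choose g hg hg0 using h
  let e : MvPolynomial (Fin (n + 1)) k ≃ₐ[k] MvPolynomial (Fin n) k[X] :=
    (MvPolynomial.renameEquiv k (finSuccEquiv' j₀)).trans (MvPolynomial.optionEquivRight k (Fin n))
  have he0 : e (.X j₀) = .C Polynomial.X := by simp [e]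
  have he1 (j) : e (.X (j₀.succAbove j)) = .X j := by simp [e]
  refine ⟨_, ?_, (e.symm.toRingEquiv.isWeaklyRegular_congr _).1
    (isWeaklyRegular_ofFn_aeval_X_reverse g hg), ?_⟩
  · simp
  · simp only [List.map_reverse, List.mem_reverse, List.mem_map, List.mem_ofFn']
    rintro _ ⟨_, ⟨j, rfl⟩, rfl⟩
    rw [← hg0 j]
    let ψ : MvPolynomial (Fin n) k[X] →ₐ[k] A := φ.comp e.symm.toAlgHom
    change ψ (aeval _ _) = _
    have h1 : ψ (.X j) = φ (.X (j₀.succAbove j)) := by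
      change φ (e.symm _) = _
      rw [← he1, AlgEquiv.symm_apply_apply]
    have h2 : (ψ.toRingHom.comp (algebraMap k[X] (MvPolynomial (Fin n) k[X]))) =
        (aeval (R := k) (φ (.X j₀))).toRingHom := by
      ext a
      · exact (ψ.commutes a).trans (by simp)
      · change φ (e.symm (.C X)) = _
        rw [← he0, AlgEquiv.symm_apply_apply]
        simp
    rw [← h2, ← h1, aeval_def]
    exact Polynomial.hom_eval₂ _ _ ψ.toRingHom _

open Polynomial in
theorem exists_contentIdeal_eq_top_eval₂_eq_zero {k A : Type*} [Field k] [CommRing A] [IsDomain A]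
    [Algebra k A] (x a : A) (ha : IsAlgebraic (Algebra.adjoin k {x}) a) :
    ∃ g : k[X][X], g.contentIdeal = ⊤ ∧ g.eval₂ (aeval (R := k) x).toRingHom a = 0 := by
  by_cases hx : IsAlgebraic k x
  · have : Algebra.IsAlgebraic k (Algebra.adjoin k {x}) :=
      (Subalgebra.isAlgebraic_iff _).1 (Algebra.isAlgebraic_adjoin_singleton_iff.2 hx)
    obtain ⟨p, hp0, hp⟩ := ha.restrictScalars k
    refine ⟨p.map C, ?_, ?_⟩
    · rw [contentIdeal_map_eq_map_contentIdeal,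
        (Ideal.eq_bot_or_top _).resolve_left (mt (contentIdeal_eq_bot_iff p).1 hp0), Ideal.map_top]
    · rw [eval₂_map, ← hp, aeval_def]
      congr 1
      ext c
      simp
  · classical
    let _ : NormalizedGCDMonoid k[X] := Classical.choice inferInstance
    obtain ⟨p, hp0, hp⟩ := ha
    let ψ : k[X] →ₐ[k] Algebra.adjoin k {x} :=
      aeval ⟨x, Algebra.self_mem_adjoin_singleton k x⟩
    have hψ : Function.Surjective ψ := by
      rintro ⟨y, hy⟩
      obtain ⟨q, hq⟩ := (Algebra.adjoin_singleton_eq_range_aeval k x ▸ hy :)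
      exact ⟨q, Subtype.ext (by simpa [ψ] using hq)⟩
    obtain ⟨q, rfl⟩ := map_surjective ψ.toRingHom hψ p
    have hq0 : q ≠ 0 := by rintro rfl; simp at hp0
    have hcomp : (algebraMap (Algebra.adjoin k {x}) A).comp ψ.toRingHom =
        (aeval (R := k) x).toRingHom := by
      ext c <;> simp [ψ]
    refine ⟨q.primPart, (isPrimitive_iff_contentIdeal_eq_top _).1 q.isPrimitive_primPart, ?_⟩
    rw [aeval_def, eval₂_map, hcomp, q.eq_C_content_mul_primPart, eval₂_mul, eval₂_C] at hp
    refine (mul_eq_zero.1 hp).resolve_left fun h ↦ hx ?_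
    exact ⟨q.content, content_eq_zero_iff.not.2 hq0, h⟩

open Cardinal in
theorem exists_isAlgebraic_adjoin_singleton_of_trdeg_le_one {k A ι : Type*} [Field k] [CommRing A]
    [IsDomain A] [Algebra k A] [Nonempty ι] (x : ι → A) (hx : Algebra.adjoin k (Set.range x) = ⊤)
    (h : Algebra.trdeg k A ≤ 1) : ∃ i, Algebra.IsAlgebraic (Algebra.adjoin k {x i}) A := by
  have : Algebra.IsAlgebraic (Algebra.adjoin k (Set.range x)) A := by
    rw [hx]
    exact ⟨fun a ↦ isAlgebraic_algebraMap (⟨a, trivial⟩ : (⊤ : Subalgebra k A))⟩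
  obtain ⟨s, hs, hb⟩ := exists_isTranscendenceBasis_subset (R := k) (Set.range x)
  have hsub : s.Subsingleton := by
    rwa [← hb.cardinalMk_eq_trdeg, Cardinal.le_one_iff_subsingleton, Set.subsingleton_coe] at h
  obtain ⟨i, hi⟩ : ∃ i, s ⊆ {x i} := by
    obtain rfl | ⟨_, hy⟩ := s.eq_empty_or_nonempty
    · exact ⟨Classical.arbitrary ι, Set.empty_subset _⟩
    · obtain ⟨i, rfl⟩ := hs hy
      exact ⟨i, fun z hz ↦ hsub hz hy⟩
  refine ⟨i, ?_⟩
  rw [isAlgebraic_iff_exists_isTranscendenceBasis_subset]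
  exact ⟨s, hi, hb⟩

theorem isIntegral_of_isIntegral_adjoin_inv {F K L : Type*} [Field F] [Field K] [Field L]
    [Algebra F K] [Algebra K L] [Algebra F L] [IsScalarTower F K L] {y : K} {z : L}
    (hy : IsIntegral (Algebra.adjoin F {y}) z)
    (hy' : IsIntegral (Algebra.adjoin F {y⁻¹}) z) : IsIntegral F z := by
  let R : Subring L := (integralClosure F L).toSubring
  have hR : IsIntegrallyClosedIn R L :=
    inferInstanceAs (IsIntegrallyClosedIn (integralClosure F L) L)
  have key : ∀ V : ValuationSubring L, R ≤ V.toSubring → ∀ t : K, algebraMap K L t ∈ V →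
      IsIntegral (Algebra.adjoin F {t}) z → z ∈ V := by
    intro V hV t ht hz
    have hle : ∀ a ∈ Algebra.adjoin F {t}, algebraMap K L a ∈ V := by
      intro a ha
      induction ha using Algebra.adjoin_induction with
      | mem x hx => rw [Set.mem_singleton_iff.mp hx]; exact ht
      | algebraMap r =>
        rw [← IsScalarTower.algebraMap_apply]
        exact hV (isIntegral_algebraMap (R := F) (x := r))
      | add x y _ _ hx hy => rw [map_add]; exact add_mem hx hy
      | mul x y _ _ hx hy => rw [map_mul]; exact mul_mem hx hy
    have : IsIntegral V z := by
      obtain ⟨p, hp, hpz⟩ := hz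
      let g : Algebra.adjoin F {t} →+* V :=
        ((algebraMap K L).comp (Algebra.adjoin F {t}).val.toRingHom).codRestrict V
          fun a => hle a a.2
      refine ⟨p.map g, hp.map g, ?_⟩
      rw [Polynomial.eval₂_map]
      exact hpz
    obtain ⟨v, hv⟩ := IsIntegrallyClosed.isIntegral_iff.mp this
    rw [← hv]
    exact v.2
  have hz : z ∈ R := by
    rw [Subring.eq_iInf_of_isIntegrallyClosedIn (R := R)]
    simp only [Subring.mem_iInf]
    rintro ⟨V, hV⟩
    rcases V.mem_or_inv_mem (algebraMap K L y) with h | h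
    · exact key V hV y h hy
    · exact key V hV _ (by rwa [map_inv₀]) hy'
  exact hz

theorem IsIntegral.of_range_le {R S L : Type*} [CommRing R] [CommRing S] [CommRing L]
    [Algebra R L] [Algebra S L] (h : (algebraMap R L).range ≤ (algebraMap S L).range) {z : L}
    (hz : IsIntegral R z) : IsIntegral S z := by
  nontriviality L
  obtain ⟨p, hp, hpz⟩ := hz
  have hl : p.map (algebraMap R L) ∈ Polynomial.lifts (algebraMap S L) := by
    rw [Polynomial.lifts_iff_coeff_lifts]
    intro n
    rw [Polynomial.coeff_map]
    exact h ⟨_, rfl⟩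
  obtain ⟨r, hr, -, hrm⟩ := Polynomial.lifts_and_natDegree_eq_and_monic hl (hp.map _)
  refine ⟨r, hrm, ?_⟩
  rw [← Polynomial.eval_map, hr, Polynomial.eval_map]
  exact hpz

theorem exists_finite_subset_isIntegral_div {A : Type*} (K : Type*) {L : Type*} [CommRing A]
    [IsDedekindDomain A] [Field K] [Algebra A K] [IsFractionRing A K] [Field L]
    [Algebra K L] [Algebra A L] [IsScalarTower A K L] [FiniteDimensional K L]
    [Algebra.IsSeparable K L] {q : A} (hq : q ≠ 0) (U : Set L)
    (hU : ∀ u ∈ U, IsIntegral A (algebraMap A L q * u))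
    (hN : ∀ u ∈ U, ∃ a : A, IsUnit a ∧ Algebra.norm K u = algebraMap A K a) :
    ∃ S ⊆ U, S.Finite ∧ ∀ u ∈ U, ∃ w ∈ S, IsIntegral A (u / w) := by
  classical
  have hinj : Function.Injective (algebraMap A L) := by
    rw [IsScalarTower.algebraMap_eq A K L]
    exact (algebraMap K L).injective.comp (IsFractionRing.injective A K)
  have : FaithfulSMul A L := (faithfulSMul_iff_algebraMap_injective A L).mpr hinj
  have : IsDedekindDomain (integralClosure A L) := integralClosure.isDedekindDomain A K L
  have : Module.Finite A (integralClosure A L) := IsIntegralClosure.finite A K L _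
  have hu0 : ∀ u ∈ U, u ≠ 0 := by
    rintro u hu rfl
    obtain ⟨a, ha, h⟩ := hN 0 hu
    rw [Algebra.norm_zero] at h
    exact ha.ne_zero (IsFractionRing.injective A K (by rw [← h, map_zero]))
  have hqL : algebraMap A L q ≠ 0 := (map_ne_zero_iff _ hinj).mpr hq
  let b : L → integralClosure A L := fun u =>
    if h : IsIntegral A (algebraMap A L q * u) then ⟨_, h⟩ else 0
  have hb : ∀ u ∈ U, (b u : L) = algebraMap A L q * u := fun u hu => by
    simp only [b, dif_pos (hU u hu)]
  have hb0 : ∀ u ∈ U, b u ≠ 0 := fun u hu h => by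
    have := hb u hu
    rw [h, ZeroMemClass.coe_zero] at this
    exact mul_ne_zero hqL (hu0 u hu) this.symm
  let Q : integralClosure A L := algebraMap A _ q ^ Module.finrank K L
  have hQ : Q ≠ 0 := pow_ne_zero _ fun h => hqL (congrArg (algebraMap (integralClosure A L) L) h)
  have hdvd : ∀ u ∈ U, b u ∣ Q := by
    intro u hu
    obtain ⟨a, ha, hau⟩ := hN u hu
    have h1 := Algebra.dvd_algebraMap_intNorm_self A (integralClosure A L) (b u)
    have h2 : Algebra.intNorm A (integralClosure A L) (b u) = q ^ Module.finrank K L * a := by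
      apply IsFractionRing.injective A K
      rw [Algebra.algebraMap_intNorm (L := L)]
      change Algebra.norm K ((b u : L)) = _
      rw [hb u hu, map_mul, hau, IsScalarTower.algebraMap_apply A K L, Algebra.norm_algebraMap,
        map_mul, map_pow]
    rw [h2, map_mul, map_pow] at h1
    exact (ha.map (algebraMap A (integralClosure A L))).dvd_mul_right.mp h1
  let c : L → Ideal (integralClosure A L) := fun u => Ideal.span {b u}
  have hfin : (c '' U).Finite := by
    have : Finite {I : Ideal (integralClosure A L) // I ∣ Ideal.span {Q}} :=
      @Finite.of_fintype _ (UniqueFactorizationMonoid.fintypeSubtypeDvd _ (by simpa using hQ))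
    refine Set.Finite.subset (@Set.toFinite _ {I | I ∣ Ideal.span {Q}} this) ?_
    rintro _ ⟨u, hu, rfl⟩
    exact Ideal.dvd_iff_le.mpr (Ideal.span_singleton_le_span_singleton.mpr (hdvd u hu))
  obtain ⟨S, hSU, hS⟩ := Set.exists_subset_bijOn U c
  refine ⟨S, hSU, hS.finite_iff_finite.mpr hfin, fun u hu => ?_⟩
  obtain ⟨w, hw, h⟩ := hS.surjOn ⟨u, hu, rfl⟩
  obtain ⟨v, hv⟩ := Ideal.span_singleton_le_span_singleton.mp h.symm.le
  have : u / w = (v : L) := by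
    have h3 := congrArg (algebraMap (integralClosure A L) L) hv
    rw [map_mul] at h3
    change (b u : L) = b w * v at h3
    rw [hb u hu, hb w (hSU hw), mul_assoc] at h3
    rw [div_eq_iff (hu0 w (hSU hw)), mul_left_cancel₀ hqL h3, mul_comm]
  exact ⟨w, hw, this ▸ v.2⟩

open IntermediateField in
theorem isFractionRing_adjoin_of_adjoin_eq_top {F K : Type*} [Field F] [Field K] [Algebra F K]
    {S : Set K} (h : IntermediateField.adjoin F S = ⊤) :
    IsFractionRing (Algebra.adjoin F S) K :=
  .of_field _ _ fun z =>
    have hz : z ∈ IntermediateField.adjoin F S := h ▸ IntermediateField.mem_top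
    have ⟨x, hx, y, hy, e⟩ := IntermediateField.mem_adjoin_iff_div.mp hz
    ⟨⟨x, hx⟩, ⟨y, hy⟩, e⟩

theorem isPrincipalIdealRing_adjoin_singleton {F K : Type*} [Field F] [Field K] [Algebra F K]
    (y : K) : IsPrincipalIdealRing (Algebra.adjoin F {y}) := by
  rw [Algebra.adjoin_singleton_eq_range_aeval]
  exact IsPrincipalIdealRing.of_surjective (Polynomial.aeval (R := F) y).rangeRestrict.toRingHom
    (AlgHom.rangeRestrict_surjective _)

open IntermediateField in
theorem exists_finite_subset_isIntegral_div_of_isIntegral_adjoin {F K L : Type*} [Field F]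
    [Field K] [Field L] [Algebra F K] [Algebra K L] [Algebra F L] [IsScalarTower F K L]
    [Algebra.IsSeparable K L] [FiniteDimensional K L] {y : K} (hy : Transcendental F y)
    (htop : F⟮y⟯ = ⊤) (B : Finset L) (U : Set L) (hU0 : ∀ u ∈ U, u ≠ 0)
    (hUB : ∀ u ∈ U, u ∈ Submodule.span F (B : Set L))
    (hU : ∀ u ∈ U, IsIntegral (Algebra.adjoin F {y}) u)
    (hU' : ∀ u ∈ U, IsIntegral (Algebra.adjoin F {y}) u⁻¹) :
    ∃ S ⊆ U, S.Finite ∧ ∀ u ∈ U, ∃ w ∈ S, IsIntegral F (u / w) := by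
  have htop' : F⟮y⁻¹⟯ = ⊤ := by
    rw [eq_top_iff, ← htop, adjoin_simple_le_iff]
    simpa using inv_mem (mem_adjoin_simple_self F y⁻¹)
  have := isFractionRing_adjoin_of_adjoin_eq_top htop
  have := isFractionRing_adjoin_of_adjoin_eq_top htop'
  have := isPrincipalIdealRing_adjoin_singleton (F := F) y
  have := isPrincipalIdealRing_adjoin_singleton (F := F) y⁻¹
  obtain ⟨q, hq, hqB⟩ := exists_integral_multiples (Algebra.adjoin F {y⁻¹}) K B
  have hnorm : ∀ u ∈ U, ∃ a : Algebra.adjoin F {y⁻¹}, IsUnit a ∧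
      Algebra.norm K u = algebraMap _ K a := by
    intro u hu
    have h1 : IsIntegral (Algebra.adjoin F {y}) (Algebra.norm K u) :=
      Algebra.isIntegral_norm K (hU u hu)
    have h2 : IsIntegral (Algebra.adjoin F {y}) (Algebra.norm K u⁻¹) :=
      Algebra.isIntegral_norm K (hU' u hu)
    obtain ⟨⟨a, ha⟩, hau⟩ := IsIntegrallyClosed.isIntegral_iff.mp h1
    obtain ⟨⟨b, hb⟩, hbu⟩ := IsIntegrallyClosed.isIntegral_iff.mp h2
    change a = _ at hau
    change b = _ at hbu
    have hab : a * b = 1 := by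
      rw [hau, hbu, ← map_mul, mul_inv_cancel₀ (hU0 u hu), map_one]
    rw [Algebra.adjoin_singleton_eq_range_aeval] at ha hb
    obtain ⟨p, rfl⟩ := ha
    obtain ⟨r, rfl⟩ := hb
    have hpr : p * r = 1 := by
      apply (transcendental_iff_injective.mp hy)
      simpa using hab
    obtain ⟨c, hc, rfl⟩ := Polynomial.isUnit_iff.mp (IsUnit.of_mul_eq_one _ hpr)
    refine ⟨algebraMap F _ c, hc.map _, ?_⟩
    rw [← hau]
    simp
  have hspan : ∀ u ∈ Submodule.span F (B : Set L),
      IsIntegral (Algebra.adjoin F {y⁻¹}) (algebraMap (Algebra.adjoin F {y⁻¹}) L q * u) := by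
    intro u hu
    induction hu using Submodule.span_induction with
    | mem x hx => simpa only [Algebra.smul_def] using hqB x hx
    | zero => rw [mul_zero]; exact isIntegral_zero
    | add x y _ _ hx hy => rw [mul_add]; exact hx.add hy
    | smul a x _ hx =>
      rw [mul_smul_comm, ← algebraMap_smul (Algebra.adjoin F {y⁻¹}) a]
      exact hx.smul _
  obtain ⟨S, hSU, hS, h⟩ :=
    exists_finite_subset_isIntegral_div K hq U (fun u hu => hspan u (hUB u hu)) hnorm
  refine ⟨S, hSU, hS, fun u hu => ?_⟩
  obtain ⟨w, hw, hi⟩ := h u hu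
  refine ⟨w, hw, isIntegral_of_isIntegral_adjoin_inv (y := y) ?_ hi⟩
  rw [div_eq_mul_inv]
  exact (hU u hu).mul (hU' w (hSU hw))

open IntermediateField in
theorem exists_finite_subset_isAlgebraic_adjoin_div {k L ι : Type*} [Field k] [Field L]
    [CharZero L] [Algebra k L] [Algebra.EssFiniteType k L] {Y : ι → L}
    (hY : IsTranscendenceBasis k Y) (j : ι) (B : Finset L) (U : Set L) (hU0 : ∀ u ∈ U, u ≠ 0)
    (hUB : ∀ u ∈ U, u ∈ Submodule.span k (B : Set L))
    (hU : ∀ u ∈ U, IsIntegral (Algebra.adjoin k (Set.range Y)) u)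
    (hU' : ∀ u ∈ U, IsIntegral (Algebra.adjoin k (Set.range Y)) u⁻¹) :
    ∃ S ⊆ U, S.Finite ∧ ∀ u ∈ U, ∃ w ∈ S,
      IsAlgebraic (Algebra.adjoin k (Y '' {j}ᶜ)) (u / w) := by
  let F := IntermediateField.adjoin k (Y '' {j}ᶜ)
  let K := IntermediateField.adjoin F {Y j}
  let y : K := AdjoinSimple.gen F (Y j)
  have hy : (algebraMap K L) y = Y j := AdjoinSimple.algebraMap_gen F (Y j)
  have htop : IntermediateField.adjoin F {y} = ⊤ := by
    apply lift_injective K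
    rw [lift_adjoin_simple, lift_top]
    rfl
  have hyF : Transcendental F y := by
    rw [← transcendental_algebraMap_iff (algebraMap K L).injective, hy, Transcendental,
      IntermediateField.isAlgebraic_adjoin_iff]
    exact hY.1.transcendental_adjoin (by simp)
  have hYF (i : ι) (hi : i ≠ j) : Y i ∈ F := subset_adjoin _ _ ⟨i, hi, rfl⟩
  have hrange : (algebraMap (Algebra.adjoin k (Set.range Y)) L).range ≤
      (algebraMap (Algebra.adjoin F {y}) L).range := by
    rintro _ ⟨⟨z, hz⟩, rfl⟩
    have hT : Algebra.adjoin k (Set.range Y) ≤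
        (Algebra.adjoin F {Y j}).restrictScalars k := by
      refine Algebra.adjoin_le ?_
      rintro _ ⟨i, rfl⟩
      by_cases hi : i = j
      · exact hi ▸ Algebra.self_mem_adjoin_singleton F (Y j)
      · exact (Algebra.adjoin F {Y j}).algebraMap_mem ⟨Y i, hYF i hi⟩
    have hz' : z ∈ (Algebra.adjoin F {y}).map (IsScalarTower.toAlgHom F K L) := by
      rw [AlgHom.map_adjoin_singleton]
      exact hy ▸ hT hz
    obtain ⟨x, hx, rfl⟩ := hz'
    exact ⟨⟨x, hx⟩, rfl⟩
  have hrangeK : (algebraMap (IntermediateField.adjoin k (Set.range Y)) L).range ≤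
      (algebraMap K L).range := by
    rintro _ ⟨⟨z, hz⟩, rfl⟩
    have hT : IntermediateField.adjoin k (Set.range Y) ≤ K.restrictScalars k := by
      refine adjoin_le_iff.2 ?_
      rintro _ ⟨i, rfl⟩
      by_cases hi : i = j
      · exact hi ▸ mem_adjoin_simple_self F (Y j)
      · exact IntermediateField.algebraMap_mem K (⟨Y i, hYF i hi⟩ : F)
    exact ⟨⟨z, hT hz⟩, rfl⟩
  have halg : Algebra.IsAlgebraic K L := by
    have := hY.isAlgebraic
    refine ⟨fun z ↦ ?_⟩
    have hz := IntermediateField.isAlgebraic_adjoin_iff.2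
      (Algebra.IsAlgebraic.isAlgebraic (R := Algebra.adjoin k (Set.range Y)) z)
    exact (hz.isIntegral.of_range_le hrangeK).isAlgebraic
  have : Algebra.EssFiniteType F L := .of_comp k F L
  have : Algebra.EssFiniteType K L := .of_comp F K L
  have : FiniteDimensional K L := Algebra.finite_of_essFiniteType_of_isAlgebraic
  have : CharZero K := (algebraMap K L).charZero
  obtain ⟨S, hSU, hS, h⟩ := exists_finite_subset_isIntegral_div_of_isIntegral_adjoin hyF htop B U
    hU0 (fun u hu ↦ Submodule.span_le_restrictScalars k F _ (hUB u hu))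
    (fun u hu ↦ (hU u hu).of_range_le hrange) (fun u hu ↦ (hU' u hu).of_range_le hrange)
  refine ⟨S, hSU, hS, fun u hu ↦ ?_⟩
  obtain ⟨w, hw, huw⟩ := h u hu
  exact ⟨w, hw, IntermediateField.isAlgebraic_adjoin_iff.1 huw.isAlgebraic⟩

open AlgebraicIndependent in
theorem IsTranscendenceBasis.isAlgebraic_of_forall_isAlgebraic_adjoin {k L ι : Type*} [Field k]
    [Field L] [Algebra k L] {Y : ι → L} (hY : IsTranscendenceBasis k Y) {z : L}
    (hz : ∀ j, IsAlgebraic (Algebra.adjoin k (Y '' {j}ᶜ)) z) : IsAlgebraic k z := by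
  have hI : (matroid k L).Indep (Set.range Y) := hY.1.to_subtype_range
  have key : z ∈ (matroid k L).closure (⋂₀ insert (Set.range Y) (Set.range fun j ↦ Y '' {j}ᶜ)) := by
    rw [hI.closure_sInter_eq_biInter_closure_of_forall_subset (Set.insert_nonempty _ _)]
    · simp only [Set.mem_insert_iff, Set.iInter_iInter_eq_or_left, Set.mem_inter_iff,
        Set.mem_range, Set.iInter_exists, Set.iInter_iInter_eq', Set.mem_iInter, matroid_closure_eq]
      exact ⟨hY.isAlgebraic.isAlgebraic z, hz⟩
    · simp [Set.image_subset_iff, Set.preimage_range]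
  have hempty : ⋂₀ insert (Set.range Y) (Set.range fun j ↦ Y '' {j}ᶜ) = ∅ := by
    refine Set.eq_empty_of_forall_notMem fun a ha ↦ ?_
    simp only [Set.sInter_insert, Set.sInter_range, Set.mem_inter_iff, Set.mem_iInter] at ha
    obtain ⟨⟨i, rfl⟩, ha⟩ := ha
    obtain ⟨i', hi', h⟩ := ha i
    exact hi' (hY.1.injective h)
  rw [hempty, matroid_closure_eq] at key
  have hk : IsAlgebraic (IntermediateField.adjoin k (∅ : Set L)) z :=
    IntermediateField.isAlgebraic_adjoin_iff.2 key
  refine (hk.isIntegral.of_range_le (S := k) ?_).isAlgebraic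
  rintro _ ⟨⟨x, hx⟩, rfl⟩
  rw [IntermediateField.adjoin_empty] at hx
  exact IntermediateField.mem_bot.1 hx

theorem exists_finite_subset_isAlgebraic_div {k L ι : Type*} [Finite ι] [Field k] [Field L]
    [CharZero L] [Algebra k L] [Algebra.EssFiniteType k L] {Y : ι → L}
    (hY : IsTranscendenceBasis k Y) (B : Finset L) (U : Set L) (hU0 : ∀ u ∈ U, u ≠ 0)
    (hUB : ∀ u ∈ U, u ∈ Submodule.span k (B : Set L))
    (hU : ∀ u ∈ U, IsIntegral (Algebra.adjoin k (Set.range Y)) u)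
    (hU' : ∀ u ∈ U, IsIntegral (Algebra.adjoin k (Set.range Y)) u⁻¹) :
    ∃ S ⊆ U, S.Finite ∧ ∀ u ∈ U, ∃ w ∈ S, IsAlgebraic k (u / w) := by
  choose S hSU hS h using fun j ↦
    exists_finite_subset_isAlgebraic_adjoin_div hY j B U hU0 hUB hU hU'
  choose! w hwS hw using h
  obtain ⟨S', hS'U, hS'⟩ := U.exists_subset_bijOn fun u j ↦ w j u
  have hfin : ((fun u j ↦ w j u) '' U).Finite := by
    refine (Set.Finite.pi fun j ↦ hS j).subset ?_
    rintro _ ⟨u, hu, rfl⟩ j -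
    exact hwS j u hu
  refine ⟨S', hS'U, hS'.finite_iff_finite.2 hfin, fun u hu ↦ ?_⟩
  obtain ⟨v, hv, hvu⟩ := hS'.surjOn ⟨u, hu, rfl⟩
  refine ⟨v, hv, hY.isAlgebraic_of_forall_isAlgebraic_adjoin fun j ↦ ?_⟩
  have hvj : w j v = w j u := congrFun hvu j
  have h0 : w j u ≠ 0 := hU0 _ (hSU j (hwS j u hu))
  have hdiv := (hw j u hu).mul (hw j v (hS'U hv)).inv
  rwa [hvj, inv_div, div_mul_div_cancel₀ h0] at hdiv

theorem exists_isTranscendenceBasis_isIntegral_algebraMap (k A L : Type*) [Field k] [CommRing A]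
    [IsDomain A] [Algebra k A] [Algebra.FiniteType k A] [Field L] [Algebra A L]
    [IsFractionRing A L] [Algebra k L] [IsScalarTower k A L] :
    ∃ (s : ℕ) (Y : Fin s → L), IsTranscendenceBasis k Y ∧
      ∀ a : A, IsIntegral (Algebra.adjoin k (Set.range Y)) (algebraMap A L a) := by
  obtain ⟨s, g, hg, hgint⟩ := exists_integral_inj_algHom_of_fg k A
  have hinj : Function.Injective (IsScalarTower.toAlgHom k A L) := IsFractionRing.injective A L
  let Y : Fin s → L := fun j ↦ algebraMap A L (g (.X j))
  have haeval : MvPolynomial.aeval Y = (IsScalarTower.toAlgHom k A L).comp g :=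
    MvPolynomial.algHom_ext fun j ↦ by simp [Y]
  have hind : AlgebraicIndependent k Y := by
    rw [AlgebraicIndependent, haeval]
    exact hinj.comp hg
  have hint (a : A) : IsIntegral (Algebra.adjoin k (Set.range Y)) (algebraMap A L a) := by
    obtain ⟨p, hp, hp0⟩ := hgint a
    refine ⟨p.map hind.aevalEquiv.toRingEquiv.toRingHom, hp.map _, ?_⟩
    have hcomp : (algebraMap (Algebra.adjoin k (Set.range Y)) L).comp
        hind.aevalEquiv.toRingEquiv.toRingHom = (algebraMap A L).comp g.toRingHom := by
      refine RingHom.ext fun q ↦ ?_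
      exact (hind.algebraMap_aevalEquiv q).trans (DFunLike.congr_fun haeval q)
    rw [Polynomial.eval₂_map, hcomp, ← Polynomial.hom_eval₂]
    exact (congrArg _ hp0).trans (map_zero _)
  refine ⟨s, Y, isTranscendenceBasis_iff_algebraicIndependent_isAlgebraic.2 ⟨hind, ⟨fun z ↦ ?_⟩⟩,
    hint⟩
  obtain ⟨a, b, -, rfl⟩ := IsFractionRing.div_surjective (A := A) z
  rw [div_eq_mul_inv]
  exact (hint a).isAlgebraic.mul (hint b).isAlgebraic.inv

theorem exists_finite_isUnit_isAlgebraic_mul {k A : Type*} (L : Type*) [Field k] [CharZero k]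
    [CommRing A] [IsDomain A] [Algebra k A] [Algebra.FiniteType k A] [Field L] [Algebra A L]
    [IsFractionRing A L] [Algebra k L] [IsScalarTower k A L] {T : Submodule k A} (hT : T.FG) :
    ∃ S : Set A, S.Finite ∧ (∀ w ∈ S, IsUnit w) ∧
      ∀ u ∈ T, IsUnit u → ∃ w ∈ S, ∃ a, IsAlgebraic k a ∧ u = a * w := by
  obtain ⟨s, Y, hY, hint⟩ := exists_isTranscendenceBasis_isIntegral_algebraMap k A L
  have : Algebra.EssFiniteType A L := .of_isLocalization L (nonZeroDivisors A)
  have : Algebra.EssFiniteType k L := .comp k A L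
  have : CharZero L := charZero_of_injective_algebraMap (algebraMap k L).injective
  have hinj : Function.Injective (algebraMap A L) := IsFractionRing.injective A L
  classical
  obtain ⟨B, rfl⟩ := hT
  let U := algebraMap A L '' {u | u ∈ Submodule.span k (B : Set A) ∧ IsUnit u}
  obtain ⟨S, hSU, hS, h⟩ : ∃ S ⊆ U, S.Finite ∧ ∀ u ∈ U, ∃ w ∈ S, IsAlgebraic k (u / w) := by
    refine exists_finite_subset_isAlgebraic_div hY (B.image (algebraMap A L)) U ?_ ?_ ?_ ?_ <;>
      rintro _ ⟨u, hu, rfl⟩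
    · exact (hu.2.map _).ne_zero
    · rw [Finset.coe_image]
      have := Submodule.mem_map_of_mem (f := (IsScalarTower.toAlgHom k A L).toLinearMap) hu.1
      rw [Submodule.map_span] at this
      exact this
    · exact hint u
    · obtain ⟨b, hb⟩ := hu.2.exists_left_inv
      rw [← eq_inv_of_mul_eq_one_left (a := algebraMap A L b) (by rw [← map_mul, hb, map_one])]
      exact hint b
  refine ⟨algebraMap A L ⁻¹' S, hS.preimage hinj.injOn, fun w hw ↦ ?_, fun u hu hu1 ↦ ?_⟩
  · obtain ⟨w', hw', hww'⟩ := hSU hw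
    exact hinj hww' ▸ hw'.2
  · obtain ⟨v, hv, hva⟩ := h _ ⟨u, ⟨hu, hu1⟩, rfl⟩
    obtain ⟨w, ⟨-, hw⟩, rfl⟩ := hSU hv
    obtain ⟨b, hb⟩ := hw.exists_left_inv
    refine ⟨w, hv, u * b, ?_, by rw [mul_assoc, hb, mul_one]⟩
    have hwb : algebraMap A L b = (algebraMap A L w)⁻¹ :=
      eq_inv_of_mul_eq_one_left (by rw [← map_mul, hb, map_one])
    rwa [← isAlgebraic_algebraMap_iff hinj, map_mul, hwb, ← div_eq_mul_inv]

open Cardinal in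
theorem not_isIntegral_adjoin_pair_of_isUnit {k A : Type*} [Field k] [CommRing A]
    [IsDomain A] [Algebra k A] (h : 2 ≤ Algebra.trdeg k A) {w : A} (hw : IsUnit w) (g : A) :
    ¬ Algebra.IsIntegral (Algebra.adjoin k (Set.range ![w, g])) A := by
  intro hint
  have hind : AlgebraicIndependent k ![w, g] :=
    (Algebra.IsAlgebraic.isTranscendenceBasis_of_lift_le_trdeg_of_finite k ![w, g]
      (by simpa using h)).1
  have hw' : hind.aevalEquiv (MvPolynomial.X 0) = ⟨w, Algebra.subset_adjoin ⟨0, rfl⟩⟩ :=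
    Subtype.ext (by simp)
  have hu : IsUnit (⟨w, Algebra.subset_adjoin ⟨0, rfl⟩⟩ : Algebra.adjoin k (Set.range ![w, g])) :=
    IsLocalHom.map_nonunit (f := algebraMap _ A) _ hw
  rw [← hw', MulEquiv.isUnit_map] at hu
  simpa using hu.map (MvPolynomial.eval (0 : Fin 2 → k))

theorem two_le_finrank_sub_finrank {k A σ : Type*} [Finite σ] [Field k] [CommRing A]
    [IsDomain A] [Algebra k A] (h : 2 ≤ Algebra.trdeg k A) (φ : MvPolynomial σ k →ₐ[k] A)
    (hφ : Function.Surjective φ) {d : ℕ} (hd : 0 < d) {w : A} (hw : IsUnit w)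
    (W : Submodule k (MvPolynomial.homogeneousSubmodule σ k d))
    (hW : ∀ f ∈ W, ∃ a, IsAlgebraic k a ∧ φ f = a * w) :
    2 ≤ Module.finrank k (MvPolynomial.homogeneousSubmodule σ k d) - Module.finrank k W := by
  have : Module.Finite k (MvPolynomial.homogeneousSubmodule σ k d) :=
    Module.Finite.iff_fg.2 (MvPolynomial.homogeneousSubmodule_fg _ _ _)
  by_contra! hlt
  have hle : Module.finrank k (_ ⧸ W) ≤ 1 := by
    have := W.finrank_quotient_add_finrank
    omega
  obtain ⟨v, hv⟩ := finrank_le_one_iff.1 hle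
  obtain ⟨g, rfl⟩ := W.mkQ_surjective v
  refine not_isIntegral_adjoin_pair_of_isUnit h hw (φ g) ?_
  set B := Algebra.adjoin k (Set.range ![w, φ g])
  have hwB : w ∈ B := Algebra.subset_adjoin ⟨0, rfl⟩
  have hgB : φ g ∈ B := Algebra.subset_adjoin ⟨1, rfl⟩
  have key (f : MvPolynomial.homogeneousSubmodule σ k d) : IsIntegral B (φ f) := by
    obtain ⟨c, hc⟩ := hv (W.mkQ f)
    have hmem : f - c • g ∈ W := by
      rw [← Submodule.Quotient.mk_eq_zero, ← Submodule.mkQ_apply, map_sub, map_smul, hc, sub_self]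
    obtain ⟨a, ha, haf⟩ := hW _ hmem
    have : φ f = a * w + c • φ g := by
      rw [← haf, ← map_smul, ← map_add]
      simp
    rw [this]
    refine .add (.mul ha.isIntegral.tower_top ?_) ?_
    · exact isIntegral_algebraMap (x := (⟨w, hwB⟩ : B))
    · exact isIntegral_algebraMap (x := (⟨c • φ g, B.smul_mem hgB c⟩ : B))
  have hX (i : σ) : IsIntegral B (φ (.X i)) := by
    refine .of_pow hd ?_
    rw [← map_pow]
    exact key ⟨.X i ^ d, by simpa using (MvPolynomial.isHomogeneous_X k i).pow d⟩
  refine ⟨fun a ↦ ?_⟩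
  obtain ⟨f, rfl⟩ := hφ a
  induction f using MvPolynomial.induction_on with
  | C c =>
    rw [← MvPolynomial.algebraMap_eq, AlgHom.commutes]
    exact isIntegral_algebraMap.tower_top
  | add p q hp hq => simpa using hp.add hq
  | mul_X p i hp => simpa using hp.mul (hX i)

open RingTheory.Sequence in
theorem two_le_trdeg_quotient_of_isWeaklyRegular_of_length_lt {k : Type*} [Field k] {n : ℕ}
    {fs : List (MvPolynomial (Fin (n + 1)) k)}
    (hfs : IsWeaklyRegular (MvPolynomial (Fin (n + 1)) k) fs) (hlt : fs.length < n)
    {P : Ideal (MvPolynomial (Fin (n + 1)) k)} [hP : P.IsPrime] {x : MvPolynomial (Fin (n + 1)) k}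
    (hx : x ∉ Ideal.ofList fs) (hPx : ∀ p ∈ P, p * x ∈ Ideal.ofList fs) :
    2 ≤ Algebra.trdeg k (MvPolynomial (Fin (n + 1)) k ⧸ P) := by
  by_contra! h
  have h1 : Algebra.trdeg k (MvPolynomial (Fin (n + 1)) k ⧸ P) ≤ 1 := by
    obtain ⟨m, hm⟩ := Cardinal.lt_aleph0.1 (h.trans Cardinal.ofNat_lt_aleph0)
    rw [hm] at h ⊢
    exact_mod_cast Nat.lt_succ_iff.1 (by exact_mod_cast h : m < 2)
  let φ := Ideal.Quotient.mkₐ k P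
  have hφ : Algebra.adjoin k (Set.range fun j ↦ φ (.X j)) = ⊤ := by
    have := congrArg (Subalgebra.map φ) (MvPolynomial.adjoin_range_X (R := k) (σ := Fin (n + 1)))
    rwa [AlgHom.map_adjoin, ← Set.range_comp, Algebra.map_top,
      (AlgHom.range_eq_top φ).2 (Ideal.Quotient.mkₐ_surjective k P)] at this
  obtain ⟨j₀, hj₀⟩ := exists_isAlgebraic_adjoin_singleton_of_trdeg_le_one _ hφ h1
  obtain ⟨gs, hlen, hgs, hgs0⟩ := exists_isWeaklyRegular_of_eval₂_eq_zero φ j₀ fun j ↦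
    exists_contentIdeal_eq_top_eval₂_eq_zero _ _ (hj₀.isAlgebraic _)
  exact hx <| mem_ofList_of_isWeaklyRegular_of_length_lt hP.ne_top hgs
    (fun g hg ↦ Ideal.Quotient.eq_zero_iff_mem.1 (hgs0 g hg)) hfs (by rwa [hlen]) hPx

theorem exists_finite_submodule_of_two_le_trdeg_quotient {k σ : Type*} [Finite σ] [Field k]
    [CharZero k] (P : Ideal (MvPolynomial σ k)) [P.IsPrime]
    (h : 2 ≤ Algebra.trdeg k (MvPolynomial σ k ⧸ P)) {d : ℕ} (hd : 0 < d) :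
    ∃ 𝒲 : Set (Submodule k (MvPolynomial.homogeneousSubmodule σ k d)), 𝒲.Finite ∧
      (∀ W ∈ 𝒲, 2 ≤ Module.finrank k (MvPolynomial.homogeneousSubmodule σ k d) -
        Module.finrank k W) ∧
      ∀ f : MvPolynomial.homogeneousSubmodule σ k d,
        (f : MvPolynomial σ k) ∈ P ∨ IsUnit (Ideal.Quotient.mk P f) → ∃ W ∈ 𝒲, f ∈ W := by
  let A := MvPolynomial σ k ⧸ P
  let φ : MvPolynomial σ k →ₐ[k] A := Ideal.Quotient.mkₐ k P
  have hφ : Function.Surjective φ := Ideal.Quotient.mkₐ_surjective k P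
  let ψ : MvPolynomial.homogeneousSubmodule σ k d →ₗ[k] A :=
    φ.toLinearMap ∘ₗ (MvPolynomial.homogeneousSubmodule σ k d).subtype
  let V (w : A) : Submodule k (MvPolynomial.homogeneousSubmodule σ k d) :=
    ((Subalgebra.toSubmodule (Subalgebra.algebraicClosure k A)).map
      (LinearMap.mulRight k w)).comap ψ
  obtain ⟨S, hS, hSu, hST⟩ := exists_finite_isUnit_isAlgebraic_mul (FractionRing A)
    ((MvPolynomial.homogeneousSubmodule_fg σ k d).map φ.toLinearMap)
  refine ⟨V '' insert 1 S, (hS.insert 1).image V, ?_, ?_⟩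
  · rintro _ ⟨w, hw, rfl⟩
    refine two_le_finrank_sub_finrank h φ hφ hd (w := w) ?_ _ ?_
    · obtain rfl | hw := hw
      exacts [isUnit_one, hSu w hw]
    · rintro f ⟨a, ha, haf⟩
      exact ⟨a, ha, haf.symm⟩
  · rintro f (hf | hf)
    · refine ⟨V 1, ⟨1, .inl rfl, rfl⟩, 0, zero_mem _, ?_⟩
      rw [map_zero]
      exact (Ideal.Quotient.eq_zero_iff_mem.2 hf).symm
    · obtain ⟨w, hw, a, ha, hfa⟩ := hST (φ f) ⟨f, f.2, rfl⟩ hf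
      exact ⟨V w, ⟨w, .inr hw, rfl⟩, a, ha, hfa.symm⟩

open RingTheory.Sequence in
theorem exists_isAssociatedPrime_mem_or_isUnit {R : Type*} [CommRing R] [IsNoetherianRing R]
    {fs : List R} (hfs : IsRegular R fs) {f : R} (hf : ¬ IsRegular R (fs ++ [f])) :
    ∃ P, IsAssociatedPrime P (R ⧸ Ideal.ofList fs) ∧ (f ∈ P ∨ IsUnit (Ideal.Quotient.mk P f)) := by
  have htop : Ideal.ofList fs ≠ ⊤ := by simpa using hfs.top_ne_smul.symm
  have : Nontrivial (R ⧸ Ideal.ofList fs) := Ideal.Quotient.nontrivial_iff.2 htop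
  by_cases hw : IsWeaklyRegular R (fs ++ [f])
  · obtain ⟨P, hP⟩ := associatedPrimes.nonempty R (R ⧸ Ideal.ofList fs)
    refine ⟨P, hP, .inr ?_⟩
    have hfP : Ideal.ofList fs ≤ P := by
      rw [← Ideal.annihilator_quotient (I := Ideal.ofList fs), ← Submodule.annihilator_top]
      exact hP.annihilator_le
    have h1 : Ideal.ofList fs ⊔ Ideal.span {f} = ⊤ := by
      by_contra h
      refine hf ⟨hw, fun h' ↦ h ?_⟩
      simpa [Ideal.ofList_append] using h'.symm
    have h2 := congrArg (Ideal.map (Ideal.Quotient.mk P)) h1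
    rw [Ideal.map_sup, (Ideal.map_eq_bot_iff_le_ker _).2 (by rwa [Ideal.mk_ker]), bot_sup_eq,
      Ideal.map_span, Set.image_singleton, Ideal.map_top] at h2
    exact Ideal.span_singleton_eq_top.1 h2
  · rw [isWeaklyRegular_append_singleton_iff] at hw
    obtain ⟨x, hx, hx'⟩ : ∃ x, f * x ∈ Ideal.ofList fs ∧ x ∉ Ideal.ofList fs := by
      by_contra! h
      exact hw ⟨hfs.1, h⟩
    obtain ⟨P, hP, hle⟩ := exists_le_isAssociatedPrime_of_isNoetherianRing R
      (Ideal.Quotient.mk (Ideal.ofList fs) x) (mt Ideal.Quotient.eq_zero_iff_mem.1 hx')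
    refine ⟨P, hP, .inl (hle ?_)⟩
    rw [Submodule.mem_colon_singleton, Submodule.mem_bot]
    exact Ideal.Quotient.eq_zero_iff_mem.2 hx

theorem IsAssociatedPrime.exists_forall_mul_mem {R : Type*} [CommRing R] [IsNoetherianRing R]
    {I P : Ideal R} (hP : IsAssociatedPrime P (R ⧸ I)) :
    ∃ x ∉ I, ∀ p ∈ P, p * x ∈ I := by
  obtain ⟨hprime, y, hy⟩ := isAssociatedPrime_iff.1 hP
  obtain ⟨x, rfl⟩ := Ideal.Quotient.mk_surjective y
  refine ⟨x, fun hx ↦ hprime.ne_top ?_, fun p hp ↦ ?_⟩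
  · rw [hy, Ideal.Quotient.eq_zero_iff_mem.2 hx, Ideal.eq_top_iff_one,
      Submodule.mem_colon_singleton, smul_zero]
    exact zero_mem _
  · rw [hy, Submodule.mem_colon_singleton, Submodule.mem_bot] at hp
    exact Ideal.Quotient.eq_zero_iff_mem.1 hp

/-- Let `k` be a field of characteristic 0 and `n ≥ 1`. Fix `1 ≤ i ≤ n` and
polynomials `f_1, …, f_{i-1}` in `k[x_0, …, x_n]` forming a regular sequence. Fix `d ≥ 1`.
Then the set of homogeneous polynomials `f` of degree `d` such that `(f_1, …, f_{i-1}, f)` is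
not a regular sequence is contained in a finite union of `k`-linear subspaces of the degree-`d`
homogeneous component, each of codimension at least 2. -/
theorem stmt0 {k : Type*} [Field k] [CharZero k] (n : ℕ) (hn : 1 ≤ n)
    (i : ℕ) (hi1 : 1 ≤ i) (hin : i ≤ n)
    (fs : List (MvPolynomial (Fin (n + 1)) k)) (hlen : fs.length = i - 1)
    (hreg : RingTheory.Sequence.IsRegular (MvPolynomial (Fin (n + 1)) k) fs)
    (d : ℕ) (hd : 1 ≤ d) :
    ∃ (N : ℕ)
      (W : Fin N → Submodule k ↥(MvPolynomial.homogeneousSubmodule (Fin (n + 1)) k d)),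
      (∀ j, Module.finrank k ↥(MvPolynomial.homogeneousSubmodule (Fin (n + 1)) k d)
          - Module.finrank k ↥(W j) ≥ 2) ∧
      ∀ f : ↥(MvPolynomial.homogeneousSubmodule (Fin (n + 1)) k d),
        ¬ RingTheory.Sequence.IsRegular (MvPolynomial (Fin (n + 1)) k)
            (fs ++ [(f : MvPolynomial (Fin (n + 1)) k)]) →
        ∃ j, f ∈ W j := by
  have hfin := associatedPrimes.finite (MvPolynomial (Fin (n + 1)) k)
    (MvPolynomial (Fin (n + 1)) k ⧸ Ideal.ofList fs)
  choose! 𝒲 h𝒲 hrank hmem using fun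
      (P : associatedPrimes (MvPolynomial (Fin (n + 1)) k)
        (MvPolynomial (Fin (n + 1)) k ⧸ Ideal.ofList fs)) ↦
    have : P.1.IsPrime := P.2.isPrime
    have ⟨_, hx, hPx⟩ := P.2.exists_forall_mul_mem
    exists_finite_submodule_of_two_le_trdeg_quotient P.1
      (two_le_trdeg_quotient_of_isWeaklyRegular_of_length_lt hreg.1 (by omega) hx hPx) hd
  have : Finite (associatedPrimes (MvPolynomial (Fin (n + 1)) k)
    (MvPolynomial (Fin (n + 1)) k ⧸ Ideal.ofList fs)) := hfin
  have : Finite ↥(⋃ P, 𝒲 P) := Set.finite_iUnion h𝒲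
  let e := Finite.equivFin ↥(⋃ P, 𝒲 P)
  refine ⟨_, fun j ↦ (e.symm j).1, fun j ↦ ?_, fun f hf ↦ ?_⟩
  · obtain ⟨P, hP⟩ := Set.mem_iUnion.1 (e.symm j).2
    exact hrank P _ hP
  · obtain ⟨P, hP, hfP⟩ := exists_isAssociatedPrime_mem_or_isUnit hreg hf
    obtain ⟨W, hW, hfW⟩ := hmem ⟨P, AssociatedPrimes.mem_iff.2 hP⟩ f hfP
    refine ⟨e ⟨W, Set.mem_iUnion.2 ⟨_, hW⟩⟩, ?_⟩
    simpa only [e.symm_apply_apply] using hfW
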